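/- Let n be an integer with n ≥ 2, let μ > 0, L > 0, σ ∈ (0,1), and α > 0. Then n/(n + μα) + √( ((n−1)/(n + μα)) · (2α³/μ) · ((1 + σ²)/(1 − σ²)) · L⁴ ) < 1 if and only if α < ( √( n² + 2μ⁴(1 − σ²)/((n−1)L⁴(1 + σ²)) ) − n ) / (2μ). -/

import Mathlib

/-- the dominant eigenvalue bound
`n/(n+μα) + √((n−1)/(n+μα)·(2α³/μ)·((1+σ²)/(1−σ²))·L⁴)` is below `1`
iff `α < (√(n² + 2μ⁴(1−σ²)/((n−1)L⁴(1+σ²))) − n)/(2μ)`. -/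
theorem step_size_characterization
    (n : ℕ) (hn : 2 ≤ n) (μ L σ α : ℝ)
    (hμ : 0 < μ) (hL : 0 < L) (hσ : σ ∈ Set.Ioo (0 : ℝ) 1) (hα : 0 < α) :
    (n : ℝ) / ((n : ℝ) + μ * α) +
        Real.sqrt ((((n : ℝ) - 1) / ((n : ℝ) + μ * α)) * (2 * α ^ 3 / μ) *
          ((1 + σ ^ 2) / (1 - σ ^ 2)) * L ^ 4) < 1 ↔
      α < (Real.sqrt ((n : ℝ) ^ 2 +
        2 * μ ^ 4 * (1 - σ ^ 2) / (((n : ℝ) - 1) * L ^ 4 * (1 + σ ^ 2))) - (n : ℝ)) / (2 * μ) := by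
  obtain ⟨h0, h1⟩ := hσ
  have hN : (2 : ℝ) ≤ n := by exact_mod_cast hn
  generalize (n : ℝ) = N at *
  have hB : 0 < 1 - σ ^ 2 := by nlinarith
  have hC : 0 < 1 + σ ^ 2 := by positivity
  have hN1 : 0 < N - 1 := by linarith
  have hA : 0 < (N - 1) * L ^ 4 * (1 + σ ^ 2) := by positivity
  have hs : 0 < N + μ * α := by positivity
  have e1 : ((N - 1) / (N + μ * α)) * (2 * α ^ 3 / μ) * ((1 + σ ^ 2) / (1 - σ ^ 2)) * L ^ 4
      = 2 * α ^ 3 * ((N - 1) * L ^ 4 * (1 + σ ^ 2)) / ((N + μ * α) * μ * (1 - σ ^ 2)) := by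
    field_simp
  rw [e1]
  generalize (N - 1) * L ^ 4 * (1 + σ ^ 2) = A at *
  generalize 1 - σ ^ 2 = B at *
  have key1 : N / (N + μ * α) + Real.sqrt (2 * α ^ 3 * A / ((N + μ * α) * μ * B)) < 1 ↔
      2 * α * (N + μ * α) * A < μ ^ 3 * B := by
    have e2 : N / (N + μ * α) = 1 - μ * α / (N + μ * α) := by
      field_simp
      ring
    rw [e2, show ∀ x y : ℝ, (1 - x + y < 1 ↔ y < x) from
      fun x y => ⟨fun h => by linarith, fun h => by linarith⟩,
      Real.sqrt_lt' (by positivity), ← sub_pos, ← sub_pos (b := 2 * α * (N + μ * α) * A)]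
    have e3 : (μ * α / (N + μ * α)) ^ 2 - 2 * α ^ 3 * A / ((N + μ * α) * μ * B)
      = (α ^ 2 / ((N + μ * α) ^ 2 * μ * B)) * (μ ^ 3 * B - 2 * α * (N + μ * α) * A) := by
      generalize N + μ * α = s at *
      field_simp
    rw [e3, mul_pos_iff_of_pos_left (by positivity)]
  have key2 : α < (Real.sqrt (N ^ 2 + 2 * μ ^ 4 * B / A) - N) / (2 * μ) ↔
      2 * α * (N + μ * α) * A < μ ^ 3 * B := by
    rw [lt_div_iff₀ (by positivity), lt_sub_iff_add_lt, Real.lt_sqrt (by positivity),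
      ← sub_pos, ← sub_pos (b := 2 * α * (N + μ * α) * A)]
    have e3 : N ^ 2 + 2 * μ ^ 4 * B / A - (α * (2 * μ) + N) ^ 2
      = (2 * μ / A) * (μ ^ 3 * B - 2 * α * (N + μ * α) * A) := by
      field_simp
      ring
    rw [e3, mul_pos_iff_of_pos_left (by positivity)]
  rw [key1, key2]
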